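/- Let G be an SBEP graph and let H = G □ K2 be its prism, consisting of G and a copy G′ of G with each vertex v of G joined to its copy v′ by a vertical edge. Then H has a Hamiltonian cycle C such that for every single-block vertex v of G, the vertical edge vv′ belongs to C. -/

import Mathlib

open SimpleGraph

variable {V : Type*} {W : Type*}

/-- A graph is `P₄`-free if it contains no induced subgraph isomorphic to the
path on four vertices. -/
def P4Free (G : SimpleGraph V) : Prop := IsEmpty (SimpleGraph.pathGraph 4 ↪g G)

/-- `R` is (the vertex set of) a connected component of `G - S`:
a maximal subset of `V(G) - S` inducing a connected subgraph. -/
def IsCompOf (G : SimpleGraph V) (S R : Set V) : Prop :=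
  R ⊆ Sᶜ ∧ (G.induce R).Connected ∧
    ∀ R' : Set V, R ⊆ R' → R' ⊆ Sᶜ → (G.induce R').Connected → R' = R

/-- The number of connected components of `G - S`. -/
noncomputable def numComp (G : SimpleGraph V) (S : Set V) : ℕ :=
  {R : Set V | IsCompOf G S R}.ncard

/-- `S` is a cutset of `G` : the graph `G - S` is disconnected. -/
def IsCutset (G : SimpleGraph V) (S : Set V) : Prop := 2 ≤ numComp G S

/-- `G` is `t`-tough: for every cutset `S`, `t * c(G - S) ≤ |S|`. -/
def Tough (t : ℝ) (G : SimpleGraph V) : Prop :=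
  ∀ S : Set V, IsCutset G S → t * (numComp G S : ℝ) ≤ (S.ncard : ℝ)

/-- `t` is the toughness of `G` : the largest `s` such that `G` is `s`-tough.
(For a complete graph no such largest `s` exists; the toughness is infinite.) -/
def IsToughness (G : SimpleGraph V) (t : ℝ) : Prop :=
  Tough t G ∧ ∀ s : ℝ, Tough s G → s ≤ t

/-- `S` is a tough-set of `G` (whose toughness is `t`): a cutset with
`|S| = t * c(G - S)`. -/
def ToughSet (G : SimpleGraph V) (t : ℝ) (S : Set V) : Prop :=
  IsCutset G S ∧ (S.ncard : ℝ) = t * (numComp G S : ℝ)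

/-- Vertex `u` is adjacent in `G` to some vertex of the set `R`. -/
def AdjToSet (G : SimpleGraph V) (u : V) (R : Set V) : Prop := ∃ v ∈ R, G.Adj u v

/-- `G` has a Hamiltonian cycle. -/
def HasHamCycle [DecidableEq V] (G : SimpleGraph V) : Prop :=
  ∃ (v : V) (w : G.Walk v v), w.IsHamiltonianCycle

/-- `G` has a spanning `k`-walk: a closed walk visiting every vertex at least once
and at most `k` times.  (In a nontrivial closed walk the base vertex occurs one
extra time in `Walk.support`, whence the correction term.) -/
def HasSpanningKWalk [DecidableEq V] (G : SimpleGraph V) (k : ℕ) : Prop :=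
  ∃ (v : V) (w : G.Walk v v), (∀ x : V, x ∈ w.support) ∧
    ∀ x : V, w.support.count x ≤ k + (if x = v then 1 else 0)

/-- The prism over `G`: the Cartesian (box) product `G □ K₂`. -/
def prism (G : SimpleGraph V) : SimpleGraph (V × Fin 2) :=
  G.boxProd (⊤ : SimpleGraph (Fin 2))

/-- The graph obtained from `G` by contracting the set `R` to a single vertex
(namely `Sum.inr ()`), which is adjacent to exactly those vertices outside `R`
having a neighbor in `R`. -/
def contractSet (G : SimpleGraph V) (R : Set V) : SimpleGraph (↥(Rᶜ) ⊕ Unit) :=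
  SimpleGraph.fromRel fun x y =>
    match x, y with
    | Sum.inl a, Sum.inl b => G.Adj ↑a ↑b
    | Sum.inl a, Sum.inr _ => ∃ r ∈ R, G.Adj ↑a r
    | _, _ => False

/-- `v` is a cutvertex of `H` : deleting `v` leaves a disconnected
(non-preconnected) graph. -/
def IsCutvertex (H : SimpleGraph W) (v : W) : Prop :=
  ¬ (H.induce ({v}ᶜ : Set W)).Preconnected

/-- `B` is a block of `H` : a maximal connected subgraph having no cutvertex of
its own. -/
def IsBlock (H : SimpleGraph W) (B : H.Subgraph) : Prop :=
  B.coe.Connected ∧ (∀ v, ¬ IsCutvertex B.coe v) ∧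
    ∀ B' : H.Subgraph, B ≤ B' → B'.coe.Connected →
      (∀ v, ¬ IsCutvertex B'.coe v) → B' = B

/-- `H` is a cycle of even length. -/
def IsEvenCycleGraph (H : SimpleGraph W) : Prop :=
  ∃ n : ℕ, Even n ∧ 3 ≤ n ∧ Nonempty (H ≃g SimpleGraph.cycleGraph n)

/-- `H` is a single edge. -/
def IsSingleEdgeGraph (H : SimpleGraph W) : Prop :=
  ∃ u v : W, u ≠ v ∧ H.Adj u v ∧ ∀ w : W, w = u ∨ w = v

/-- `H` is a simple block EP (SBEP) graph: a connected graph in which every block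
is an even cycle or a single edge, and every vertex lies in at most two blocks. -/
def IsSBEP (H : SimpleGraph W) : Prop :=
  H.Connected ∧
    (∀ B : H.Subgraph, IsBlock H B → IsEvenCycleGraph B.coe ∨ IsSingleEdgeGraph B.coe) ∧
    ∀ (v : W) (B₁ B₂ B₃ : H.Subgraph),
      IsBlock H B₁ ∧ v ∈ B₁.verts → IsBlock H B₂ ∧ v ∈ B₂.verts →
      IsBlock H B₃ ∧ v ∈ B₃.verts → B₁ = B₂ ∨ B₁ = B₃ ∨ B₂ = B₃

/-- `v` is a single-block vertex of `H` : it lies in exactly one block. -/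
def SingleBlockVertex (H : SimpleGraph W) (v : W) : Prop :=
  ∃! B : H.Subgraph, IsBlock H B ∧ v ∈ B.verts

/-- A walk traversing an edge splits at that edge, in one of the two directions. -/
lemma SimpleGraph.Walk.exists_append_cons_of_mem_edges {G : SimpleGraph V} {a b x y : V}
    (w : G.Walk a b) (h : s(x, y) ∈ w.edges) :
    (∃ (p : G.Walk a x) (hxy : G.Adj x y) (q : G.Walk y b), w = p.append (.cons hxy q)) ∨
      ∃ (p : G.Walk a y) (hyx : G.Adj y x) (q : G.Walk x b), w = p.append (.cons hyx q) := by
  induction w with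
  | nil => simp at h
  | @cons u v c huv r ih =>
    rw [Walk.edges_cons, List.mem_cons] at h
    rcases h with h | h
    · rcases Sym2.eq_iff.1 h with ⟨rfl, rfl⟩ | ⟨rfl, rfl⟩
      · exact .inl ⟨.nil, huv, r, rfl⟩
      · exact .inr ⟨.nil, huv, r, rfl⟩
    · rcases ih h with ⟨p, e, q, rfl⟩ | ⟨p, e, q, rfl⟩
      · exact .inl ⟨.cons huv p, e, q, rfl⟩
      · exact .inr ⟨.cons huv p, e, q, rfl⟩

/-- For every `v ∈ D`, the prism over `S` has a Hamiltonian path joining the two copies of `v`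
and traversing the vertical edges of all other vertices in `D`. -/
def PrismHamiltonianOn (G : SimpleGraph V) (S D : Set V) : Prop :=
  ∀ v ∈ D, ∃ P : (prism G).Walk (v, 0) (v, 1), P.IsPath ∧ (∀ x, x ∈ P.support ↔ x.1 ∈ S) ∧
    ∀ d ∈ D, d ≠ v → s((d, (0 : Fin 2)), (d, (1 : Fin 2))) ∈ P.edges

namespace PrismHamiltonianOn

variable {G : SimpleGraph V} {S S₁ S₂ D D₁ D₂ : Set V}

lemma subset (h : PrismHamiltonianOn G S D) : D ⊆ S := fun v hv => by
  obtain ⟨P, -, hP, -⟩ := h v hv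
  exact (hP (v, 0)).1 P.start_mem_support

/-- Replacing a vertical edge of a path by a path on a set meeting the former only there. -/
lemma splice {a b x y : V × Fin 2} {u : V} (hS : S₁ ∩ S₂ = {u}) {p : (prism G).Walk a x}
    {hxy : (prism G).Adj x y} {q : (prism G).Walk y b} (hP : (p.append (.cons hxy q)).IsPath)
    (hPS : ∀ z, z ∈ (p.append (.cons hxy q)).support ↔ z.1 ∈ S₁)
    (hu : ∀ i, (u, i) = x ∨ (u, i) = y)
    {r : (prism G).Walk x y} (hr : r.IsPath) (hrS : ∀ z, z ∈ r.support ↔ z.1 ∈ S₂) :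
    (p.append (r.append q)).IsPath ∧
      ∀ z, z ∈ (p.append (r.append q)).support ↔ z.1 ∈ S₁ ∪ S₂ := by
  constructor
  · have hsq : q.support = y :: q.support.tail := q.cons_tail_support.symm
    have hsr : r.support = x :: r.support.tail := r.cons_tail_support.symm
    have hmem : ∀ z ∈ r.support, z ∈ p.support ∨ z ∈ q.support → z = x ∨ z = y := by
      intro z hz hz'
      have h1 : z.1 ∈ S₁ := (hPS z).1 (by simpa using! hz'.imp_right .inr)
      have h2 : z.1 = u := by
        have : z.1 ∈ S₁ ∩ S₂ := ⟨h1, (hrS z).1 hz⟩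
        rwa [hS] at this
      obtain ⟨z1, i⟩ := z
      obtain rfl : z1 = u := h2
      exact hu i
    rw [Walk.isPath_def, Walk.support_append] at hP ⊢
    rw [Walk.support_append]
    rw [Walk.isPath_def] at hr
    simp only [Walk.support_cons, List.tail_cons] at hP
    have hxp : x ∈ p.support := p.end_mem_support
    rw [hsr, List.cons_append, List.tail_cons]
    rw [hsr] at hr hmem
    rw [hsq] at hP hmem
    have hy : y ∉ p.support := fun h => by
      have := List.disjoint_of_nodup_append hP
      exact this h (by simp)
    grind [List.nodup_append, List.nodup_cons]
  · intro z
    have := hPS z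
    have := hrS z
    have hx := r.start_mem_support
    have hy := r.end_mem_support
    simp only [Walk.mem_support_append_iff, Walk.support_cons, List.mem_cons, Set.mem_union] at *
    grind

lemma exists_path_union {u v : V} (h₁ : PrismHamiltonianOn G S₁ D₁)
    (h₂ : PrismHamiltonianOn G S₂ D₂) (hS : S₁ ∩ S₂ = {u}) (hu₁ : u ∈ D₁) (hu₂ : u ∈ D₂)
    (hv : v ∈ D₁) (hvu : v ≠ u) :
    ∃ P : (prism G).Walk (v, 0) (v, 1), P.IsPath ∧ (∀ x, x ∈ P.support ↔ x.1 ∈ S₁ ∪ S₂) ∧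
      ∀ d ∈ D₁ ∪ D₂, d ≠ u → d ≠ v → s((d, (0 : Fin 2)), (d, (1 : Fin 2))) ∈ P.edges := by
  obtain ⟨P, hP, hPS, hPD⟩ := h₁ v hv
  obtain ⟨r, hr, hrS, hrD⟩ := h₂ u hu₂
  rcases P.exists_append_cons_of_mem_edges (hPD u hu₁ hvu.symm) with
    ⟨p, e, q, rfl⟩ | ⟨p, e, q, rfl⟩
  · obtain ⟨hp, hs⟩ := splice hS hP hPS (fun i => by fin_cases i <;> simp) hr hrS
    refine ⟨_, hp, hs, fun d hd hdu hdv => ?_⟩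
    rcases hd with hd | hd
    · have := hPD d hd hdv
      simp [hdu] at this ⊢
      tauto
    · have := hrD d hd hdu
      simp [this]
  · obtain ⟨hp, hs⟩ := splice hS hP hPS (fun i => by fin_cases i <;> simp) hr.reverse
      (by simpa using hrS)
    refine ⟨_, hp, hs, fun d hd hdu hdv => ?_⟩
    rcases hd with hd | hd
    · have := hPD d hd hdv
      simp [hdu] at this ⊢
      tauto
    · have := hrD d hd hdu
      simp [this]

lemma union {u : V} (h₁ : PrismHamiltonianOn G S₁ D₁) (h₂ : PrismHamiltonianOn G S₂ D₂)
    (hS : S₁ ∩ S₂ = {u}) (hu₁ : u ∈ D₁) (hu₂ : u ∈ D₂) :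
    PrismHamiltonianOn G (S₁ ∪ S₂) ((D₁ ∪ D₂) \ {u}) := by
  rintro v ⟨hv | hv, hvu⟩
  · obtain ⟨P, hP, hPS, hPD⟩ := exists_path_union h₁ h₂ hS hu₁ hu₂ hv hvu
    exact ⟨P, hP, hPS, fun d hd => hPD d hd.1 hd.2⟩
  · obtain ⟨P, hP, hPS, hPD⟩ :=
      exists_path_union h₂ h₁ (Set.inter_comm S₁ S₂ ▸ hS) hu₂ hu₁ hv hvu
    rw [Set.union_comm] at hPS hPD
    exact ⟨P, hP, hPS, fun d hd => hPD d hd.1 hd.2⟩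

/-- The zigzag walk over a path, traversing every vertical edge. -/
lemma exists_zigzag {a b : V} (q : G.Walk a b) (hq : q.IsPath) (i : Fin 2) :
    ∃ P : (prism G).Walk (a, i) (b, Fin.ofNat 2 (i + q.length + 1)), P.IsPath ∧
      (∀ x, x ∈ P.support ↔ x.1 ∈ q.support) ∧
      ∀ d ∈ q.support, s((d, (0 : Fin 2)), (d, (1 : Fin 2))) ∈ P.edges := by
  have hadj : ∀ (c : V) (i : Fin 2), (prism G).Adj (c, i) (c, i + 1) := by
    intro c i
    simp only [prism, boxProd_adj]
    fin_cases i <;> simp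
  have hvert : ∀ (c : V) (i : Fin 2),
      s((c, (0 : Fin 2)), (c, (1 : Fin 2))) = s((c, i), (c, i + 1)) := by
    intro c i
    fin_cases i <;> simp
  have hfib : ∀ (z : V × Fin 2) (c : V) (i : Fin 2), z.1 = c ↔ z = (c, i) ∨ z = (c, i + 1) := by
    rintro ⟨z, j⟩ c i
    fin_cases i <;> fin_cases j <;> simp
  induction q generalizing i with
  | @nil a =>
    have he : Fin.ofNat 2 (i + (Walk.nil : G.Walk a a).length + 1) = i + 1 := by
      ext
      simp [Fin.val_add]
    rw [he]
    refine ⟨.cons (hadj a i) .nil, ?_, ?_, ?_⟩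
    · simp
    · intro x
      simp [hfib x a i]
    · intro d hd
      obtain rfl : d = a := by simpa using hd
      simp [hvert d i]
  | @cons a c b hac q ih =>
    rw [Walk.cons_isPath_iff] at hq
    have hP := ih hq.1 (i + 1)
    have he : Fin.ofNat 2 ((i + 1 : Fin 2) + q.length + 1) =
        Fin.ofNat 2 (i + (Walk.cons hac q).length + 1) := by
      ext
      simp [Fin.val_add]
      omega
    rw [he] at hP
    obtain ⟨P, hP, hPS, hPD⟩ := hP
    have hac' : (prism G).Adj (a, i + 1) (c, i + 1) := by
      simpa [prism, boxProd_adj] using hac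
    refine ⟨.cons (hadj a i) (.cons hac' P), ?_, ?_, ?_⟩
    · simp only [Walk.cons_isPath_iff, Walk.support_cons, List.mem_cons, hPS]
      refine ⟨⟨hP, hq.2⟩, ?_⟩
      rintro (h | h)
      · simp at h
      · exact hq.2 h
    · intro x
      simp only [Walk.support_cons, List.mem_cons, hPS, hfib x a i]
      tauto
    · intro d hd
      rw [Walk.support_cons, List.mem_cons] at hd
      rcases hd with rfl | hd
      · simp [hvert d i]
      · exact List.mem_cons_of_mem _ (List.mem_cons_of_mem _ (hPD d hd))

lemma of_forall_exists_path
    (h : ∀ v ∈ S, ∃ (a b : V) (q : G.Walk a b), q.IsPath ∧ Even q.length ∧ G.Adj v a ∧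
      G.Adj b v ∧ ∀ x, x ∈ q.support ↔ x ∈ S ∧ x ≠ v) : PrismHamiltonianOn G S S := by
  intro v hv
  obtain ⟨a, b, q, hq, hlen, hva, hbv, hS⟩ := h v hv
  have hP := exists_zigzag q hq 0
  have he : Fin.ofNat 2 ((0 : Fin 2) + q.length + 1) = 1 := by
    obtain ⟨k, hk⟩ := hlen
    rw [hk]
    ext
    simp
    omega
  rw [he] at hP
  obtain ⟨P, hP, hPS, hPD⟩ := hP
  have h0 : (prism G).Adj (v, 0) (a, 0) := by simpa [prism, boxProd_adj] using hva
  have h1 : (prism G).Adj (b, 1) (v, 1) := by simpa [prism, boxProd_adj] using hbv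
  refine ⟨.cons h0 (P.concat h1), ?_, ?_, ?_⟩
  · rw [Walk.cons_isPath_iff, Walk.concat_isPath_iff]
    simp [Walk.support_concat, hPS, hS, hP]
  · rintro ⟨x, i⟩
    by_cases hx : x = v
    · subst hx
      fin_cases i <;> simp [Walk.support_concat, hv]
    · simp [Walk.support_concat, hPS, hS, hx]
  · intro d hd hdv
    have := hPD d ((hS d).2 ⟨hd, hdv⟩)
    simp [Walk.edges_concat, this]

lemma exists_isHamiltonianCycle [DecidableEq V] (h : PrismHamiltonianOn G Set.univ D)
    (hD : D.Nontrivial) :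
    ∃ (v₀ : V × Fin 2) (w : (prism G).Walk v₀ v₀), w.IsHamiltonianCycle ∧
      ∀ v ∈ D, s((v, (0 : Fin 2)), (v, (1 : Fin 2))) ∈ w.edges := by
  obtain ⟨v, hv, d, hd, hvd⟩ := hD
  obtain ⟨P, hP, hPS, hPD⟩ := h v hv
  have hadj : (prism G).Adj (v, 1) (v, 0) := by simp [prism, boxProd_adj]
  have hnot : s((v, (1 : Fin 2)), (v, (0 : Fin 2))) ∉ P.edges := by
    intro hmem
    have hd0 := (hPS (d, 0)).2 trivial
    rcases P.exists_append_cons_of_mem_edges hmem with ⟨p, e, q, rfl⟩ | ⟨p, e, q, rfl⟩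
    · rw [Walk.isPath_def, Walk.support_append] at hP
      exact List.disjoint_of_nodup_append hP p.start_mem_support (by simp)
    · have hp := (Walk.isPath_iff_nil.1 hP.of_append_left).eq_nil
      have hq := (Walk.isPath_iff_nil.1 hP.of_append_right.of_cons).eq_nil
      subst hp hq
      simp [hvd.symm] at hd0
  refine ⟨(v, 1), .cons hadj P, ?_, ?_⟩
  · rw [Walk.isHamiltonianCycle_iff_isCycle_and_support_count_tail_eq_one]
    exact ⟨(Walk.cons_isCycle_iff _ _).2 ⟨hP, hnot⟩,
      hP.isHamiltonian_of_mem fun x => (hPS x).2 trivial⟩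
  · intro x hx
    by_cases hxv : x = v
    · simp [hxv]
    · simp [hPD x hx hxv]

end PrismHamiltonianOn

lemma SimpleGraph.exists_isPath_of_forall_adj {G : SimpleGraph V} (g : ℕ → V)
    (hadj : ∀ k, G.Adj (g k) (g (k + 1))) (k : ℕ) (hg : Set.InjOn g (Set.Iic k)) :
    ∃ q : G.Walk (g 0) (g k), q.IsPath ∧ q.length = k ∧ ∀ x, x ∈ q.support ↔ ∃ j ≤ k, g j = x := by
  induction k with
  | zero => exact ⟨.nil, by simp, rfl, fun x => by simp [eq_comm]⟩
  | succ k ih =>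
    obtain ⟨q, hq, hlen, hS⟩ := ih (hg.mono (Set.Iic_subset_Iic.2 k.le_succ))
    refine ⟨q.concat (hadj k), ?_, by simp [hlen], fun x => ?_⟩
    · rw [Walk.concat_isPath_iff]
      refine ⟨hq, fun h => ?_⟩
      obtain ⟨j, hj, hjk⟩ := (hS _).1 h
      have := hg (Set.mem_Iic.2 (hj.trans k.le_succ)) (Set.mem_Iic.2 le_rfl) hjk
      omega
    · simp only [Walk.support_concat, List.mem_append, hS, List.mem_singleton]
      constructor
      · rintro (⟨j, hj, rfl⟩ | rfl)
        · exact ⟨j, by omega, rfl⟩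
        · exact ⟨k + 1, le_rfl, rfl⟩
      · rintro ⟨j, hj, rfl⟩
        rcases hj.lt_or_eq with h | rfl
        · exact .inl ⟨j, by omega, rfl⟩
        · exact .inr rfl

namespace PrismHamiltonianOn

variable {G : SimpleGraph V}

lemma of_isSingleEdgeGraph {B : G.Subgraph} (h : IsSingleEdgeGraph B.coe) :
    PrismHamiltonianOn G B.verts B.verts := by
  obtain ⟨⟨u, hu⟩, ⟨v, hv⟩, huv, hadj, hB⟩ := h
  have hadj : G.Adj u v := B.adj_sub hadj
  have hmem : ∀ x, x ∈ B.verts ↔ x = u ∨ x = v := fun x =>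
    ⟨fun hx => by simpa using hB ⟨x, hx⟩, by rintro (rfl | rfl) <;> assumption⟩
  refine of_forall_exists_path fun w hw => ?_
  rcases (hmem w).1 hw with rfl | rfl
  · refine ⟨v, v, .nil, by simp, by simp, hadj, hadj.symm, fun x => ?_⟩
    have := hadj.ne
    rw [hmem]
    simp
    grind
  · refine ⟨u, u, .nil, by simp, by simp, hadj.symm, hadj, fun x => ?_⟩
    have := hadj.ne
    rw [hmem]
    simp
    grind

lemma of_isEvenCycleGraph {B : G.Subgraph} (h : IsEvenCycleGraph B.coe) :
    PrismHamiltonianOn G B.verts B.verts := by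
  obtain ⟨n, hn, hn3, ⟨e⟩⟩ := h
  obtain ⟨m, rfl⟩ : ∃ m, n = m + 2 := ⟨n - 2, by omega⟩
  refine of_forall_exists_path fun v hv => ?_
  set i := e ⟨v, hv⟩ with hi
  set f : Fin (m + 2) → V := fun a => (e.symm a).1 with hf
  have hfinj : Function.Injective f := Subtype.val_injective.comp e.symm.injective
  have hfv : f i = v := by simp [hf, hi]
  have hfadj : ∀ a, G.Adj (f a) (f (a + 1)) := fun a =>
    B.adj_sub (e.symm.map_adj_iff.2 (cycleGraph_adj.2 (.inr (by abel))) : B.coe.Adj _ _)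
  have hsucc : ∀ k, Fin.ofNat (m + 2) (k + 1) = Fin.ofNat (m + 2) k + 1 := fun k => by
    ext
    simp [Fin.val_add]
  set g : ℕ → V := fun k => f (i + Fin.ofNat (m + 2) (k + 1)) with hg
  have hginj : Set.InjOn g (Set.Iic m) := by
    intro a ha b hb hab
    have := congrArg Fin.val (add_left_cancel (hfinj hab))
    simp only [Set.mem_Iic] at ha hb
    simp only [Fin.val_ofNat] at this
    rwa [Nat.mod_eq_of_lt (by omega), Nat.mod_eq_of_lt (by omega), Nat.add_right_cancel_iff] at this
  obtain ⟨q, hq, hlen, hS⟩ := exists_isPath_of_forall_adj g (fun k => by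
    have := hfadj (i + Fin.ofNat (m + 2) (k + 1))
    rwa [add_assoc, ← hsucc] at this) m hginj
  refine ⟨_, _, q, hq, ?_, ?_, ?_, fun x => ?_⟩
  · rw [hlen]
    simpa [Nat.even_add] using hn
  · have := hfadj i
    rwa [hfv] at this
  · have := hfadj (i + Fin.ofNat (m + 2) (m + 1))
    rwa [add_assoc, ← hsucc, show Fin.ofNat (m + 2) (m + 1 + 1) = 0 by ext; simp, add_zero,
      hfv] at this
  · rw [hS]
    constructor
    · rintro ⟨j, hj, rfl⟩
      refine ⟨(e.symm _).2, fun h => ?_⟩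
      have h := hfinj (h.trans hfv.symm)
      rw [add_eq_left] at h
      have := congrArg Fin.val h
      simp only [Fin.val_ofNat, Fin.val_zero] at this
      rw [Nat.mod_eq_of_lt (by omega)] at this
      omega
    · rintro ⟨hx, hxv⟩
      set d := e ⟨x, hx⟩ - i with hd
      have hd0 : d ≠ 0 := by
        intro h
        have : e ⟨x, hx⟩ = e ⟨v, hv⟩ := sub_eq_zero.1 h
        exact hxv (by simpa using this)
      have hd0' : d.val ≠ 0 := fun h => hd0 (Fin.ext h)
      refine ⟨d.val - 1, by omega, ?_⟩
      have : Fin.ofNat (m + 2) (d.val - 1 + 1) = d := by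
        ext
        simp only [Fin.val_ofNat]
        rw [Nat.mod_eq_of_lt (by omega)]
        omega
      have hgx : g (d.val - 1) = f (i + d) := congrArg (fun z => f (i + z)) this
      rw [hgx]
      simp [hd, hf]

end PrismHamiltonianOn

lemma SimpleGraph.Reachable.exists_lift {H : SimpleGraph W} {K : SimpleGraph V} {f : W → V}
    (hf : ∀ a b, K.Adj (f a) b → ∃ a', f a' = b ∧ H.Adj a a') {a : W} {y : V}
    (h : K.Reachable (f a) y) : ∃ a', f a' = y ∧ H.Reachable a a' := by
  obtain ⟨p⟩ := h
  generalize hx : f a = x at p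
  induction p generalizing a with
  | nil => exact ⟨a, hx, .rfl⟩
  | cons hadj _ ih =>
    subst hx
    obtain ⟨a', ha', haa'⟩ := hf _ _ hadj
    obtain ⟨c, hc, hac⟩ := ih ha'
    exact ⟨c, hc, haa'.reachable.trans hac⟩

lemma SimpleGraph.Walk.reachable_deleteVerts_spanningCoe {G : SimpleGraph V} {x y : V}
    {K : G.Subgraph} {Z : Set V} (p : G.Walk x y) (hp : p.toSubgraph ≤ K)
    (hZ : ∀ z ∈ p.support, z ∉ Z) : (K.deleteVerts Z).spanningCoe.Reachable x y := by
  refine ⟨p.transfer _ fun e he => ?_⟩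
  induction e with
  | _ a b =>
    have hab := hp.2 (Walk.adj_toSubgraph_iff_mem_edges.2 he)
    exact Subgraph.deleteVerts_adj.2 ⟨K.edge_vert hab, hZ _ (p.fst_mem_support_of_mem_edges he),
      K.edge_vert hab.symm, hZ _ (p.snd_mem_support_of_mem_edges he), hab⟩

namespace SimpleGraph.Subgraph

variable {G : SimpleGraph V} {B B₁ B₂ K : G.Subgraph}

/-- A nonempty subgraph that stays connected after deleting at most one vertex. -/
def Nonseparable (B : G.Subgraph) : Prop :=
  B.verts.Nonempty ∧ ∀ Z : Set V, Z.Subsingleton → ∀ x ∈ B.verts \ Z, ∀ y ∈ B.verts \ Z,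
    (B.deleteVerts Z).spanningCoe.Reachable x y

lemma reachable_induce_compl_iff (z : B.verts) (x y : ({z}ᶜ : Set B.verts)) :
    (B.coe.induce {z}ᶜ).Reachable x y ↔
      (B.deleteVerts {z.1}).spanningCoe.Reachable x.1.1 y.1.1 := by
  have hne : ∀ w : ({z}ᶜ : Set B.verts), w.1.1 ≠ z.1 := fun w h => w.2 (Subtype.ext h)
  constructor
  · refine Reachable.map (⟨fun w => w.1.1, fun {a b} hab => ?_⟩ :
      B.coe.induce {z}ᶜ →g (B.deleteVerts {z.1}).spanningCoe)
    exact deleteVerts_adj.2 ⟨a.1.2, hne a, b.1.2, hne b, hab⟩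
  · intro h
    obtain ⟨a', ha', h⟩ := h.exists_lift (H := B.coe.induce {z}ᶜ) (f := fun w => w.1.1)
      fun a b hab => by
        obtain ⟨-, -, hb, hbz, hab⟩ := deleteVerts_adj.1 hab
        exact ⟨⟨⟨b, hb⟩, fun h => hbz (congrArg Subtype.val h)⟩, rfl, hab⟩
    rwa [Subtype.ext (Subtype.ext ha')] at h

lemma reachable_coe_iff (x y : B.verts) :
    B.coe.Reachable x y ↔ B.spanningCoe.Reachable x.1 y.1 := by
  constructor
  · exact Reachable.map (⟨fun w => w.1, id⟩ : B.coe →g B.spanningCoe)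
  · intro h
    obtain ⟨a', ha', h⟩ := h.exists_lift (H := B.coe) (f := fun w => w.1)
      fun a b hab => ⟨⟨b, B.edge_vert hab.symm⟩, rfl, hab⟩
    rwa [Subtype.ext ha'] at h

lemma nonseparable_iff :
    B.Nonseparable ↔ B.coe.Connected ∧ ∀ v, ¬ IsCutvertex B.coe v := by
  simp only [IsCutvertex, not_not]
  constructor
  · rintro ⟨hne, h⟩
    refine ⟨@SimpleGraph.Connected.mk _ _ (fun x y => ?_) hne.to_subtype, fun z x y => ?_⟩
    · rw [reachable_coe_iff]
      simpa using h ∅ Set.subsingleton_empty x (by simp) y (by simp)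
    · rw [reachable_induce_compl_iff]
      exact h {z.1} Set.subsingleton_singleton _ ⟨x.1.2, fun h => x.2 (Subtype.ext h)⟩ _
        ⟨y.1.2, fun h => y.2 (Subtype.ext h)⟩
  · rintro ⟨hc, h⟩
    refine ⟨Set.nonempty_coe_sort.1 hc.nonempty, fun Z hZ x hx y hy => ?_⟩
    have hconn : Disjoint B.verts Z → (B.deleteVerts Z).spanningCoe.Reachable x y := by
      intro hdisj
      rw [← deleteVerts_inter_verts_left_eq, hdisj.inter_eq, deleteVerts_empty]
      exact (reachable_coe_iff ⟨x, hx.1⟩ ⟨y, hy.1⟩).1 (hc.preconnected _ _)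
    rcases hZ.eq_empty_or_singleton with rfl | ⟨z, rfl⟩
    · exact hconn (by simp)
    · by_cases hz : z ∈ B.verts
      · exact (reachable_induce_compl_iff ⟨z, hz⟩
          ⟨⟨x, hx.1⟩, fun h => hx.2 (congrArg Subtype.val h)⟩
          ⟨⟨y, hy.1⟩, fun h => hy.2 (congrArg Subtype.val h)⟩).1 (h _ _ _)
      · exact hconn (by simpa using hz)

lemma Nonseparable.sup (hB : B.Nonseparable)
    (hK : ∀ Z : Set V, Z.Subsingleton → ∀ x ∈ K.verts \ Z, ∃ b ∈ B.verts \ Z,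
      (K.deleteVerts Z).spanningCoe.Reachable x b) : (B ⊔ K).Nonseparable := by
  refine ⟨hB.1.mono (by simp), fun Z hZ => ?_⟩
  have key : ∀ x ∈ (B ⊔ K).verts \ Z, ∃ b ∈ B.verts \ Z,
      ((B ⊔ K).deleteVerts Z).spanningCoe.Reachable x b := by
    rintro x ⟨hx | hx, hxZ⟩
    · exact ⟨x, ⟨hx, hxZ⟩, .rfl⟩
    · obtain ⟨b, hb, h⟩ := hK Z hZ x ⟨hx, hxZ⟩
      exact ⟨b, hb, h.mono (spanningCoe_le_of_le (deleteVerts_mono le_sup_right))⟩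
  intro x hx y hy
  obtain ⟨b, hb, hxb⟩ := key x hx
  obtain ⟨c, hc, hyc⟩ := key y hy
  exact hxb.trans (((hB.2 Z hZ b hb c hc).mono
    (spanningCoe_le_of_le (deleteVerts_mono le_sup_left))).trans hyc.symm)

/-- Adding an ear to a nonseparable subgraph keeps it nonseparable. -/
lemma Nonseparable.sup_toSubgraph (hB : B.Nonseparable) {u w : V} (hu : u ∈ B.verts)
    (hw : w ∈ B.verts) {p : G.Walk u w} (hp : p.IsPath) : (B ⊔ p.toSubgraph).Nonseparable := by
  classical
  refine hB.sup fun Z hZ x hx => ?_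
  have hxp : x ∈ p.support := p.mem_verts_toSubgraph.1 hx.1
  have hsub := congrArg Walk.toSubgraph (p.take_spec hxp)
  rw [Walk.toSubgraph_append] at hsub
  by_cases h : ∀ z ∈ (p.takeUntil x hxp).support, z ∉ Z
  · exact ⟨u, ⟨hu, h u (by simp)⟩, ((p.takeUntil x hxp).reachable_deleteVerts_spanningCoe
      (hsub ▸ le_sup_left) h).symm⟩
  · push Not at h
    obtain ⟨z, hz, hzZ⟩ := h
    have h' : ∀ y ∈ (p.dropUntil x hxp).support, y ∉ Z := by
      intro y hy hyZ
      obtain rfl := hZ hyZ hzZ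
      have hyx : y ≠ x := fun h => hx.2 (h ▸ hyZ)
      have hnd := hp.support_nodup
      rw [← p.take_spec hxp, Walk.support_append] at hnd
      refine List.disjoint_of_nodup_append hnd hz ?_
      rw [← Walk.cons_tail_support, List.mem_cons] at hy
      exact hy.resolve_left hyx
    exact ⟨w, ⟨hw, h' w (by simp)⟩, (p.dropUntil x hxp).reachable_deleteVerts_spanningCoe
      (hsub ▸ le_sup_right) h'⟩

lemma nonseparable_singletonSubgraph (v : V) : (G.singletonSubgraph v).Nonseparable := by
  refine ⟨by simp, fun Z _ x hx y hy => ?_⟩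
  obtain rfl : x = v := hx.1
  obtain rfl : y = x := hy.1
  rfl

lemma nonseparable_subgraphOfAdj {u v : V} (h : G.Adj u v) : (G.subgraphOfAdj h).Nonseparable := by
  refine ⟨by simp, fun Z _ x hx y hy => ?_⟩
  by_cases hxy : x = y
  · rw [hxy]
  · refine Adj.reachable (deleteVerts_adj.2 ⟨hx.1, hx.2, hy.1, hy.2, ?_⟩)
    have h1 := hx.1
    have h2 := hy.1
    simp only [subgraphOfAdj_verts, Set.mem_insert_iff, Set.mem_singleton_iff] at h1 h2
    simp only [subgraphOfAdj_adj]
    grind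

end SimpleGraph.Subgraph

open SimpleGraph.Subgraph

section Block

variable {G : SimpleGraph V} {B B₁ B₂ K : G.Subgraph}

lemma IsBlock.nonseparable (h : IsBlock G B) : B.Nonseparable := nonseparable_iff.2 ⟨h.1, h.2.1⟩

lemma IsBlock.eq_of_le (h : IsBlock G B) (hle : B ≤ K) (hK : K.Nonseparable) : K = B :=
  h.2.2 K hle (nonseparable_iff.1 hK).1 (nonseparable_iff.1 hK).2

lemma SimpleGraph.Subgraph.Nonseparable.exists_isBlock_le [Finite V] (h : K.Nonseparable) :
    ∃ B, IsBlock G B ∧ K ≤ B := by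
  obtain ⟨B, hKB, hB⟩ := Finite.exists_le_maximal h
  obtain ⟨h1, h2⟩ := nonseparable_iff.1 hB.prop
  exact ⟨B, ⟨h1, h2, fun B' hle h3 h4 =>
    (hB.eq_of_le (nonseparable_iff.2 ⟨h3, h4⟩) hle).symm⟩, hKB⟩

lemma IsBlock.eq_of_mem_of_mem (h₁ : IsBlock G B₁) (h₂ : IsBlock G B₂) {x y : V} (hxy : x ≠ y)
    (hx₁ : x ∈ B₁.verts) (hx₂ : x ∈ B₂.verts) (hy₁ : y ∈ B₁.verts) (hy₂ : y ∈ B₂.verts) :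
    B₁ = B₂ := by
  have h : (B₁ ⊔ B₂).Nonseparable := h₁.nonseparable.sup fun Z hZ w hw => by
    by_cases hxZ : x ∈ Z
    · have hyZ : y ∉ Z := fun hyZ => hxy (hZ hxZ hyZ)
      exact ⟨y, ⟨hy₁, hyZ⟩, h₂.nonseparable.2 Z hZ w hw y ⟨hy₂, hyZ⟩⟩
    · exact ⟨x, ⟨hx₁, hxZ⟩, h₂.nonseparable.2 Z hZ w hw x ⟨hx₂, hxZ⟩⟩
  rw [← h₁.eq_of_le le_sup_left h, h₂.eq_of_le le_sup_right h]

/-- A connected subgraph that is a union of blocks. -/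
structure IsBlockUnion (K : G.Subgraph) : Prop where
  connected : K.Connected
  exists_isBlock_adj : ∀ a b, K.Adj a b → ∃ B ≤ K, IsBlock G B ∧ B.Adj a b
  exists_isBlock_mem : ∀ v ∈ K.verts, ∃ B ≤ K, IsBlock G B ∧ v ∈ B.verts

lemma IsBlock.isBlockUnion (h : IsBlock G B) : IsBlockUnion B :=
  ⟨⟨h.1⟩, fun _ _ hab => ⟨B, le_rfl, h, hab⟩, fun _ hv => ⟨B, le_rfl, h, hv⟩⟩

lemma IsBlockUnion.sup (hK : IsBlockUnion K) (hB : IsBlock G B) {u : V} (huK : u ∈ K.verts)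
    (huB : u ∈ B.verts) : IsBlockUnion (K ⊔ B) where
  connected := connected_sup hK.connected.preconnected hB.isBlockUnion.connected.preconnected
    ⟨u, huK, huB⟩
  exists_isBlock_adj := by
    rintro a b (h | h)
    · obtain ⟨B', hle, hB'⟩ := hK.exists_isBlock_adj a b h
      exact ⟨B', hle.trans le_sup_left, hB'⟩
    · exact ⟨B, le_sup_right, hB, h⟩
  exists_isBlock_mem := by
    rintro v (h | h)
    · obtain ⟨B', hle, hB'⟩ := hK.exists_isBlock_mem v h
      exact ⟨B', hle.trans le_sup_left, hB'⟩
    · exact ⟨B, le_sup_right, hB, h⟩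

lemma IsBlockUnion.inter_eq_singleton (hK : IsBlockUnion K) (hB : IsBlock G B) (hBK : ¬ B ≤ K)
    {u : V} (huK : u ∈ K.verts) (huB : u ∈ B.verts) : K.verts ∩ B.verts = {u} := by
  classical
  refine Set.eq_singleton_iff_unique_mem.2 ⟨⟨huK, huB⟩, fun w ⟨hwK, hwB⟩ => ?_⟩
  by_contra hwu
  obtain ⟨p, hp⟩ := (connected_iff_forall_exists_walk_subgraph K).1 hK.connected |>.2 huK hwK
  have hq := Walk.toSubgraph_bypass_le_toSubgraph.trans hp
  have hqB := hB.eq_of_le le_sup_left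
    (hB.nonseparable.sup_toSubgraph huB hwB p.bypass_isPath)
  rw [sup_eq_left] at hqB
  cases h : p.bypass with
  | nil => exact hwu rfl
  | @cons _ c _ huc r =>
    rw [h] at hq hqB
    have hadj : (Walk.cons huc r).toSubgraph.Adj u c := by simp
    obtain ⟨B', hle, hB', hB'adj⟩ := hK.exists_isBlock_adj u c (hq.2 hadj)
    have := hB'.eq_of_mem_of_mem hB huc.ne (B'.edge_vert hB'adj) huB
      (B'.edge_vert hB'adj.symm) (B.edge_vert (hqB.2 hadj).symm)
    exact hBK (this ▸ hle)

end Block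

/-- `D` contains every vertex of the block union `K` lying in only one block of `K`, and the prism
over `K` is Hamiltonian through the vertical edges of `D`. -/
structure PrismHamiltonianBlockUnion {G : SimpleGraph V} (K : G.Subgraph) (D : Set V) : Prop
    extends IsBlockUnion K where
  nontrivial : D.Nontrivial
  hamiltonian : PrismHamiltonianOn G K.verts D
  mem_of_unique : ∀ v ∈ K.verts, (∀ B₁ ≤ K, ∀ B₂ ≤ K, IsBlock G B₁ → IsBlock G B₂ →
    v ∈ B₁.verts → v ∈ B₂.verts → B₁ = B₂) → v ∈ D

section SBEP

variable {G : SimpleGraph V} {B K : G.Subgraph} {D : Set V}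

lemma IsSBEP.prismHamiltonianBlockUnion (hG : IsSBEP G) (hB : IsBlock G B) :
    PrismHamiltonianBlockUnion B B.verts where
  toIsBlockUnion := hB.isBlockUnion
  nontrivial := by
    rw [← Set.nontrivial_coe_sort]
    rcases hG.2.1 B hB with ⟨n, -, hn, ⟨e⟩⟩ | ⟨u, v, huv, -⟩
    · have : Nontrivial (Fin n) := Fin.nontrivial_iff_two_le.2 (by omega)
      exact e.toEquiv.nontrivial
    · exact ⟨u, v, huv⟩
  hamiltonian := (hG.2.1 B hB).elim .of_isEvenCycleGraph .of_isSingleEdgeGraph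
  mem_of_unique := fun _ hv _ => hv

lemma PrismHamiltonianBlockUnion.sup (hG : IsSBEP G) (hK : PrismHamiltonianBlockUnion K D)
    (hB : IsBlock G B) (hBK : ¬ B ≤ K) {u : V} (huK : u ∈ K.verts) (huB : u ∈ B.verts) :
    PrismHamiltonianBlockUnion (K ⊔ B) ((D ∪ B.verts) \ {u}) := by
  have hB' := hG.prismHamiltonianBlockUnion hB
  have hinter := hK.inter_eq_singleton hB hBK huK huB
  have huD : u ∈ D := hK.mem_of_unique u huK fun B₁ h₁ B₂ h₂ hB₁ hB₂ hu₁ hu₂ => by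
    rcases hG.2.2 u B₁ B₂ B ⟨hB₁, hu₁⟩ ⟨hB₂, hu₂⟩ ⟨hB, huB⟩ with h | h | h
    · exact h
    · exact absurd (h ▸ h₁) hBK
    · exact absurd (h ▸ h₂) hBK
  refine ⟨hK.toIsBlockUnion.sup hB huK huB, ?_, ?_, ?_⟩
  · obtain ⟨x, hx, hxu⟩ := hK.nontrivial.exists_ne u
    obtain ⟨y, hy, hyu⟩ := hB'.nontrivial.exists_ne u
    refine ⟨x, ⟨.inl hx, hxu⟩, y, ⟨.inr hy, hyu⟩, ?_⟩
    rintro rfl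
    have : x ∈ K.verts ∩ B.verts := ⟨hK.hamiltonian.subset hx, hy⟩
    rw [hinter] at this
    exact hxu this
  · exact hK.hamiltonian.union hB'.hamiltonian hinter huD huB
  · intro v hv huniq
    refine ⟨?_, ?_⟩
    · rcases hv with hv | hv
      · exact .inl (hK.mem_of_unique v hv fun B₁ h₁ B₂ h₂ =>
          huniq B₁ (h₁.trans le_sup_left) B₂ (h₂.trans le_sup_left))
      · exact .inr hv
    · rintro rfl
      obtain ⟨B₀, hle, hB₀, hv₀⟩ := hK.exists_isBlock_mem v huK
      exact hBK (huniq B₀ (hle.trans le_sup_left) B le_sup_right hB₀ hB hv₀ huB ▸ hle)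

lemma IsSBEP.exists_prismHamiltonianBlockUnion_verts_eq_univ [Finite V] (hG : IsSBEP G) :
    ∃ (K : G.Subgraph) (D : Set V), PrismHamiltonianBlockUnion K D ∧ K.verts = Set.univ := by
  obtain ⟨v⟩ := hG.1.nonempty
  obtain ⟨B, hB, -⟩ := (nonseparable_singletonSubgraph (G := G) v).exists_isBlock_le
  obtain ⟨K, -, ⟨D, hK⟩, hmax⟩ := Finite.exists_le_maximal
    (p := fun K : G.Subgraph => ∃ D, PrismHamiltonianBlockUnion K D)
    ⟨_, hG.prismHamiltonianBlockUnion hB⟩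
  refine ⟨K, D, hK, Set.eq_univ_of_forall fun w => ?_⟩
  by_contra hw
  obtain ⟨x, hx⟩ := hK.connected.nonempty
  obtain ⟨p⟩ := hG.1.preconnected x w
  obtain ⟨⟨⟨a, b⟩, hab⟩, -, ha, hb⟩ := p.exists_boundary_dart K.verts hx hw
  obtain ⟨B', hB', hle⟩ := (nonseparable_subgraphOfAdj hab).exists_isBlock_le
  have haB : a ∈ B'.verts := hle.1 (by simp)
  have hbB : b ∈ B'.verts := hle.1 (by simp)
  exact hb ((hmax ⟨_, hK.sup hG hB' (fun h => hb (h.1 hbB)) ha haB⟩ le_sup_left).1 (.inr hbB))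

end SBEP

/-- The prism over an SBEP graph `G` has a hamiltonian cycle
using the vertical edge `vv'` for every single-block vertex `v` of `G`. -/
theorem stmt_6 {V : Type*} [Fintype V] [DecidableEq V] (G : SimpleGraph V)
    (hG : IsSBEP G) :
    ∃ (v₀ : V × Fin 2) (w : (prism G).Walk v₀ v₀), w.IsHamiltonianCycle ∧
      ∀ v : V, SingleBlockVertex G v →
        s((v, (0 : Fin 2)), (v, (1 : Fin 2))) ∈ w.edges := by
  obtain ⟨K, D, hK, huniv⟩ := hG.exists_prismHamiltonianBlockUnion_verts_eq_univ
  obtain ⟨v₀, w, hw, hD⟩ := (huniv ▸ hK.hamiltonian).exists_isHamiltonianCycle hK.nontrivial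
  exact ⟨v₀, w, hw, fun v hv => hD v <| hK.mem_of_unique v (huniv ▸ Set.mem_univ v)
    fun B₁ _ B₂ _ h₁ h₂ hv₁ hv₂ => hv.unique ⟨h₁, hv₁⟩ ⟨h₂, hv₂⟩⟩
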